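/- Let 𝒜 be a minimally self-adjusting BST algorithm for which there exist constants α>0 and D such that for every access (to element s, with search path P containing z side alternations, producing after-tree A): (i) s is the root of A; (ii) A has at least α·(|P|−z) leaves; (iii) every element of P larger than s has right-depth at most D in A, and every element of P smaller than s has left-depth at most D in A. Then 𝒜 satisfies the access lemma via the SOL potential. -/

import Mathlib

namespace Paper

inductive BTree where
  | nil : BTree
  | node : BTree → ℕ → BTree → BTree
deriving DecidableEq

namespace BTree

def keys : BTree → Finset ℕ
  | nil => ∅
  | node l x r => insert x (keys l ∪ keys r)

def root? : BTree → Option ℕ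
  | nil => none
  | node _ x _ => some x

def isBST : BTree → Prop
  | nil => True
  | node l x r => (∀ y ∈ keys l, y < x) ∧ (∀ y ∈ keys r, x < y) ∧ isBST l ∧ isBST r

def subtree? (s : ℕ) : BTree → Option BTree
  | nil => none
  | node l x r => if s = x then some (node l x r) else if s < x then subtree? s l else subtree? s r

/-- The set of keys of the subtree rooted at `s` (∅ if `s` is not in the tree). -/
def subtreeKeys (T : BTree) (s : ℕ) : Finset ℕ := ((subtree? s T).map keys).getD ∅

/-- The search path to `s`, listed from the root downwards. -/
def pathList (s : ℕ) : BTree → List ℕ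
  | nil => []
  | node l x r => if s = x then [x] else if s < x then x :: pathList s l else x :: pathList s r

def pathSet (T : BTree) (s : ℕ) : Finset ℕ := (pathList s T).toFinset

def nodeDepth (s : ℕ) : BTree → ℕ
  | nil => 0
  | node l x r => if s = x then 0 else if s < x then nodeDepth s l + 1 else nodeDepth s r + 1

/-- Number of right-going edges on the path from the root to `s`. -/
def rightDepth (s : ℕ) : BTree → ℕ
  | nil => 0
  | node l x r => if s = x then 0 else if s < x then rightDepth s l else rightDepth s r + 1

/-- Number of left-going edges on the path from the root to `s`. -/
def leftDepth (s : ℕ) : BTree → ℕ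
  | nil => 0
  | node l x r => if s = x then 0 else if s < x then leftDepth s l + 1 else leftDepth s r

def leafCount : BTree → ℕ
  | nil => 0
  | node nil _ nil => 1
  | node l _ r => leafCount l + leafCount r

/-- The wing partition of a BST, each wing listed from its topmost node downwards. -/
def wings : BTree → List (List ℕ)
  | nil => []
  | node l x r =>
    match wings l with
    | [] => [x] :: wings r
    | wl :: rest => (x :: wl) :: (rest ++ wings r)

end BTree

open BTree

/-- The left-leaning path on `[n]`: `n` at the root, `1` at the deepest node. -/
def leftPathTree : ℕ → BTree
  | 0 => BTree.nil
  | n + 1 => BTree.node (leftPathTree n) (n + 1) BTree.nil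

/-- Number of side alternations (w.r.t. `s`) between adjacent elements of a list. -/
def sideAlt (s : ℕ) : List ℕ → ℕ
  | x :: y :: rest => (if (x < s ∧ s < y) ∨ (y < s ∧ s < x) then 1 else 0) + sideAlt s (y :: rest)
  | _ => 0

/-- The set of elements involved in side alternations (w.r.t. `s`) in a list. -/
def zigzagSet (s : ℕ) : List ℕ → Finset ℕ
  | x :: y :: rest =>
    (if (x < s ∧ s < y) ∨ (y < s ∧ s < x) then ({x, y} : Finset ℕ) else ∅) ∪ zigzagSet s (y :: rest)
  | _ => ∅

noncomputable def wsum (w : ℕ → ℝ) (X : Finset ℕ) : ℝ := ∑ b ∈ X, w b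

/-- Partial sum-of-logs potential of the set `X` in tree `T` (binary logarithm). -/
noncomputable def phiOn (w : ℕ → ℝ) (T : BTree) (X : Finset ℕ) : ℝ :=
  ∑ a ∈ X, Real.logb 2 (wsum w (subtreeKeys T a))

noncomputable def phiAll (w : ℕ → ℝ) (T : BTree) : ℝ := phiOn w T (keys T)

/-- A single access of a minimally self-adjusting BST algorithm: the accessed element `s`
becomes the root, the keys are unchanged, and every node off the search path keeps its
subtree; hence the search path is replaced by an after-tree rooted at `s` and the pendent
subtrees are reattached in the unique order-preserving way. -/
structure IsAccess (T : BTree) (s : ℕ) (T' : BTree) : Prop where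
  hT : isBST T
  hT' : isBST T'
  hs : s ∈ keys T
  hkeys : keys T' = keys T
  hroot : root? T' = some s
  hpendent : ∀ a ∈ keys T, a ∉ pathSet T s → subtree? a T' = subtree? a T

/-- The algorithm (viewed as the set of accesses it may perform) satisfies the access lemma
via the sum-of-logs potential. -/
def SatisfiesAL (Alg : BTree → ℕ → BTree → Prop) : Prop :=
  ∃ C : ℝ, 0 ≤ C ∧ ∀ T s T', Alg T s T' → ∀ w : ℕ → ℝ, (∀ i ∈ keys T, 0 < w i) →
    ((pathSet T s).card : ℝ) ≤
      phiAll w T - phiAll w T' + C * (1 + Real.logb 2 (wsum w (keys T) / w s))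

/-- `X` is subtree-disjoint (w.r.t. the tree after the access). -/
def SubtreeDisjoint (T' : BTree) (X : Finset ℕ) : Prop :=
  ∀ a ∈ X, ∀ b ∈ X, a ≠ b → subtreeKeys T' a ∩ subtreeKeys T' b = ∅

/-- `X` is monotone: all elements on one side of `s`, with equal right-depth
(resp. left-depth) in the after-tree.  (For nodes of the search path, depth in the
after-tree coincides with depth in `T'`.) -/
def IsMonotone (s : ℕ) (T' : BTree) (X : Finset ℕ) : Prop :=
  ((∀ x ∈ X, s < x) ∧ ∃ d, ∀ x ∈ X, rightDepth x T' = d) ∨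
  ((∀ x ∈ X, x < s) ∧ ∃ d, ∀ x ∈ X, leftDepth x T' = d)

/-- The after-tree minus its root can be partitioned into (at most) `k` monotone sets. -/
def MonotoneDecomp (T : BTree) (s : ℕ) (T' : BTree) (k : ℕ) : Prop :=
  ∃ M : Fin k → Finset ℕ,
    (∀ i, IsMonotone s T' (M i)) ∧
    (∀ i j, i ≠ j → Disjoint (M i) (M j)) ∧
    Finset.univ.biUnion M = pathSet T s \ {s}

/-- The leaves of the after-tree: path nodes having no path node as proper descendant in `T'`. -/
def afterLeaves (T : BTree) (s : ℕ) (T' : BTree) : Finset ℕ :=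
  (pathSet T s).filter (fun x => subtreeKeys T' x ∩ pathSet T s = {x})

/-- Rotate-to-root: `s` becomes the root and ancestor relations are otherwise preserved,
equivalently `T'(a) = T(a) ∩ (-∞,s)` for path nodes `a < s` and symmetrically for `a > s`. -/
def IsRotateToRoot (T : BTree) (s : ℕ) (T' : BTree) : Prop :=
  subtreeKeys T' s = keys T ∧
  ∀ a ∈ pathSet T s,
    (a < s → subtreeKeys T' a = (subtreeKeys T a).filter (fun b => b < s)) ∧
    (s < a → subtreeKeys T' a = (subtreeKeys T a).filter (fun b => s < b))

def pendTree : Option ℕ → BTree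
  | none => BTree.nil
  | some u => BTree.node BTree.nil u BTree.nil

def buildLeft (l : List (ℕ × Option ℕ)) : BTree :=
  l.foldl (fun t vc => BTree.node (pendTree vc.2) vc.1 t) BTree.nil

def buildRight (l : List (ℕ × Option ℕ)) : BTree :=
  l.foldl (fun t vc => BTree.node t vc.1 (pendTree vc.2)) BTree.nil

/-- Global view of splay: process the reversed search path `v₁, v₂, …` in pairs; if a pair
lies on the same side of `s`, the more ancestral element is removed from its path and
becomes a (pendant) child of the other.  Returns the two spines (elements `< s` and `> s`),
deepest first, each spine node with its optional pendant child. -/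
def splaySpines (s : ℕ) : List ℕ → List (ℕ × Option ℕ) × List (ℕ × Option ℕ)
  | [] => ([], [])
  | [v] => if v < s then ([(v, none)], []) else ([], [(v, none)])
  | v :: u :: rest =>
    let p := splaySpines s rest
    if v < s then
      if u < s then ((v, some u) :: p.1, p.2)
      else ((v, none) :: p.1, (u, none) :: p.2)
    else
      if u < s then ((u, none) :: p.1, (v, none) :: p.2)
      else (p.1, (v, some u) :: p.2)

/-- The after-tree of a splay access, built from the reversed search path without `s`. -/
def splayAfterTree (s : ℕ) (l : List ℕ) : BTree :=
  BTree.node (buildLeft (splaySpines s l).1) s (buildRight (splaySpines s l).2)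

/-- A splay access: a valid access whose after-tree (the restriction of `T'` to the search
path) is the splay after-tree. -/
def IsSplayAccess (T : BTree) (s : ℕ) (T' : BTree) : Prop :=
  IsAccess T s T' ∧
  ∀ x ∈ pathSet T s,
    subtreeKeys T' x ∩ pathSet T s = subtreeKeys (splayAfterTree s (pathList s T).reverse.tail) x

/-- A path-balance access: a valid access whose after-tree is a balanced BST of depth
`⌈log₂ (1 + |P|)⌉` rooted at `s`. -/
def IsPathBalanceAccess (T : BTree) (s : ℕ) (T' : BTree) : Prop :=
  IsAccess T s T' ∧
  ∀ x ∈ pathSet T s, nodeDepth x T' ≤ Nat.clog 2 (1 + (pathSet T s).card)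

def isParent (Q : BTree) (x y : ℕ) : Prop := pathList y Q = pathList x Q ++ [y]

/-- One step of a decomposition: a (descending) path `Pi` of `Q` is rearranged into a tree,
all other nodes keeping their subtrees. -/
def StepRel (Q Q' : BTree) (Pi : Finset ℕ) : Prop :=
  isBST Q' ∧ keys Q' = keys Q ∧
  (∃ l : List ℕ, l ≠ [] ∧ List.Chain' (isParent Q) l ∧ l.toFinset = Pi) ∧
  (∀ a ∈ keys Q, a ∉ Pi → subtree? a Q' = subtree? a Q)

/-- The transformation of the before-path `P0` (as a tree) into the after-tree `A` admits a
local decomposition with window size `wdw`. -/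
def HasLocalDecomp (s : ℕ) (P0 A : BTree) (wdw : ℕ) : Prop :=
  ∃ (k : ℕ) (Q : ℕ → BTree) (Ps : ℕ → Finset ℕ),
    1 ≤ k ∧ Q 0 = P0 ∧ Q k = A ∧
    (∀ i < k, StepRel (Q i) (Q (i + 1)) (Ps i)) ∧
    s ∈ Ps 0 ∧
    (∀ i, i + 1 < k → (Ps (i + 1) \ Ps i).Nonempty) ∧
    (∀ i, i + 1 < k → (Ps (i + 1) ∩ Ps i).Nonempty) ∧
    (∀ i j, i + 1 < j → j < k → Disjoint (Ps i \ Ps (i + 1)) (Ps j)) ∧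
    (∀ i < k, (Ps i).card ≤ wdw)

/-- The search path to `s` in `T`, as a tree (the before-path of the transformation). -/
def pathTree (s : ℕ) : BTree → BTree
  | BTree.nil => BTree.nil
  | BTree.node l x r =>
    if s = x then BTree.node BTree.nil x BTree.nil
    else if s < x then BTree.node (pathTree s l) x BTree.nil
    else BTree.node BTree.nil x (pathTree s r)

/-- `A` is the after-tree of the access `(T, s, T')`: the restriction of `T'` to the search path. -/
def IsAfterTree (T : BTree) (s : ℕ) (T' A : BTree) : Prop :=
  isBST A ∧ keys A = pathSet T s ∧
  ∀ x ∈ pathSet T s, subtreeKeys A x = subtreeKeys T' x ∩ pathSet T s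

/-- The algorithm is local with window size `wdw`. -/
def IsLocal (Alg : BTree → ℕ → BTree → Prop) (wdw : ℕ) : Prop :=
  ∀ T s T', Alg T s T' → ∀ A, IsAfterTree T s T' A → HasLocalDecomp s (pathTree s T) A wdw

open scoped Classical in
noncomputable def stair (n : ℕ) (h : ℕ → ℕ) (s : ℕ) : Finset ℕ :=
  (Finset.Icc 1 n).filter
    (fun b => ∀ b' ∈ Finset.Icc 1 n, ((s < b' ∧ b' < b) ∨ (b < b' ∧ b' < s)) → h b' < h b)

open scoped Classical in
noncomputable def nbhd (n : ℕ) (h : ℕ → ℕ) (a : ℕ) : Finset ℕ :=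
  (Finset.Icc 1 n).filter
    (fun b => ∀ b' ∈ Finset.Icc 1 n, b' ≠ a → min a b ≤ b' → b' ≤ max a b → h b' < h a)

/-- Geometric sum-of-logs partial potential. -/
noncomputable def phiGeo (n : ℕ) (h : ℕ → ℕ) (w : ℕ → ℝ) (X : Finset ℕ) : ℝ :=
  ∑ a ∈ X, Real.logb 2 (wsum w (nbhd n h a))

/-- `l` is (the reversal of) a valid search path to `s`, without `s`, deepest element first. -/
def ValidRevPath (s : ℕ) (l : List ℕ) : Prop :=
  l.Nodup ∧ s ∉ l ∧
  l.Pairwise (fun a b => (a < s → b < s → b < a) ∧ (s < a → s < b → a < b))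

end Paper

namespace Paper

namespace BTree

@[simp] theorem subtreeKeys_nil (a : ℕ) : subtreeKeys nil a = ∅ := rfl

theorem subtreeKeys_node (l r : BTree) (x a : ℕ) :
    subtreeKeys (node l x r) a =
      if a = x then keys (node l x r) else if a < x then subtreeKeys l a else subtreeKeys r a := by
  unfold subtreeKeys
  rw [subtree?]
  split_ifs <;> simp

@[simp] theorem mem_keys_node {l r : BTree} {x a : ℕ} :
    a ∈ keys (node l x r) ↔ a = x ∨ a ∈ keys l ∨ a ∈ keys r := by
  simp [keys]

theorem subtreeKeys_subset_keys (T : BTree) (a : ℕ) : subtreeKeys T a ⊆ keys T := by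
  induction T with
  | nil => simp
  | node l x r ihl ihr =>
    intro b hb
    rw [subtreeKeys_node] at hb
    split_ifs at hb
    · exact hb
    · exact mem_keys_node.2 (.inr (.inl (ihl hb)))
    · exact mem_keys_node.2 (.inr (.inr (ihr hb)))

theorem self_mem_subtreeKeys {T : BTree} (hT : isBST T) {a : ℕ} (ha : a ∈ keys T) :
    a ∈ subtreeKeys T a := by
  induction T with
  | nil => simp [keys] at ha
  | node l x r ihl ihr =>
    obtain ⟨h1, h2, h3, h4⟩ := hT
    rw [subtreeKeys_node]
    grind [mem_keys_node]

theorem mem_subtreeKeys_of_between {T : BTree} (hT : isBST T) {a b c d : ℕ}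
    (hc : c ∈ subtreeKeys T a) (hd : d ∈ subtreeKeys T a) (hb : b ∈ keys T)
    (hcb : c ≤ b) (hbd : b ≤ d) : b ∈ subtreeKeys T a := by
  induction T with
  | nil => simp at hc
  | node l x r ihl ihr =>
    obtain ⟨h1, h2, h3, h4⟩ := hT
    have hl := subtreeKeys_subset_keys l a
    have hr := subtreeKeys_subset_keys r a
    rw [subtreeKeys_node] at hc hd ⊢
    grind [mem_keys_node]

theorem subtreeKeys_laminar {T : BTree} (hT : isBST T) {a b c : ℕ}
    (ha : a ∈ keys T) (hb : b ∈ keys T)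
    (hca : c ∈ subtreeKeys T a) (hcb : c ∈ subtreeKeys T b) :
    a ∈ subtreeKeys T b ∨ b ∈ subtreeKeys T a := by
  induction T with
  | nil => simp at hca
  | node l x r ihl ihr =>
    obtain ⟨h1, h2, h3, h4⟩ := hT
    have hla := subtreeKeys_subset_keys l a
    have hra := subtreeKeys_subset_keys r a
    have hlb := subtreeKeys_subset_keys l b
    have hrb := subtreeKeys_subset_keys r b
    rw [subtreeKeys_node] at hca hcb ⊢
    rw [subtreeKeys_node]
    grind [mem_keys_node]

theorem lt_of_rightDepth_eq {T : BTree} (hT : isBST T) {a b c : ℕ}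
    (ha : a ∈ keys T) (hb : b ∈ keys T) (hab : a < b)
    (h : rightDepth a T = rightDepth b T) (hc : c ∈ subtreeKeys T a) : c < b := by
  induction T with
  | nil => simp at hc
  | node l x r ihl ihr =>
    obtain ⟨h1, h2, h3, h4⟩ := hT
    have hla := subtreeKeys_subset_keys l a
    have hra := subtreeKeys_subset_keys r a
    rw [subtreeKeys_node] at hc
    rw [rightDepth, rightDepth] at h
    grind [mem_keys_node]

theorem lt_of_leftDepth_eq {T : BTree} (hT : isBST T) {a b c : ℕ}
    (ha : a ∈ keys T) (hb : b ∈ keys T) (hab : b < a)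
    (h : leftDepth a T = leftDepth b T) (hc : c ∈ subtreeKeys T a) : b < c := by
  induction T with
  | nil => simp at hc
  | node l x r ihl ihr =>
    obtain ⟨h1, h2, h3, h4⟩ := hT
    have hla := subtreeKeys_subset_keys l a
    have hra := subtreeKeys_subset_keys r a
    rw [subtreeKeys_node] at hc
    rw [leftDepth, leftDepth] at h
    grind [mem_keys_node]

theorem mem_keys_of_mem_pathList {T : BTree} {s a : ℕ} (ha : a ∈ pathList s T) : a ∈ keys T := by
  induction T with
  | nil => simp [pathList] at ha
  | node l x r ihl ihr =>
    rw [pathList] at ha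
    grind [mem_keys_node]

theorem mem_keys_of_mem_pathSet {T : BTree} {s a : ℕ} (ha : a ∈ pathSet T s) : a ∈ keys T :=
  mem_keys_of_mem_pathList (List.mem_toFinset.1 ha)

theorem self_mem_pathList {T : BTree} (hT : isBST T) {s : ℕ} (hs : s ∈ keys T) :
    s ∈ pathList s T := by
  induction T with
  | nil => simp [keys] at hs
  | node l x r ihl ihr =>
    obtain ⟨h1, h2, h3, h4⟩ := hT
    rw [pathList]
    grind [mem_keys_node]

theorem mem_subtreeKeys_of_mem_pathList {T : BTree} (hT : isBST T) {s a : ℕ} (hs : s ∈ keys T)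
    (ha : a ∈ pathList s T) : s ∈ subtreeKeys T a := by
  induction T with
  | nil => simp [keys] at hs
  | node l x r ihl ihr =>
    obtain ⟨h1, h2, h3, h4⟩ := hT
    have hl := @mem_keys_of_mem_pathList l s a
    have hr := @mem_keys_of_mem_pathList r s a
    rw [pathList] at ha
    rw [subtreeKeys_node]
    grind [mem_keys_node]

theorem pathList_pairwise {T : BTree} (hT : isBST T) (s : ℕ) :
    (pathList s T).Pairwise (fun a b => a ≠ b ∧ subtreeKeys T b ⊆ subtreeKeys T a) := by
  induction T with
  | nil => simp [pathList]
  | node l x r ihl ihr =>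
    obtain ⟨h1, h2, h3, h4⟩ := hT
    rw [pathList]
    split_ifs
    · simp
    · have key : ∀ a ∈ pathList s l, a < x := fun a ha => h1 a (mem_keys_of_mem_pathList ha)
      refine List.pairwise_cons.2 ⟨fun a ha => ⟨(key a ha).ne', ?_⟩, ?_⟩
      · rw [subtreeKeys_node l r x x, if_pos rfl]
        exact subtreeKeys_subset_keys _ _
      · refine (ihl h3).imp_of_mem fun {a b} ha hb hab => ?_
        rw [subtreeKeys_node, subtreeKeys_node, if_neg (key a ha).ne, if_neg (key b hb).ne,
          if_pos (key a ha), if_pos (key b hb)]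
        exact hab
    · have key : ∀ a ∈ pathList s r, x < a := fun a ha => h2 a (mem_keys_of_mem_pathList ha)
      refine List.pairwise_cons.2 ⟨fun a ha => ⟨(key a ha).ne, ?_⟩, ?_⟩
      · rw [subtreeKeys_node l r x x, if_pos rfl]
        exact subtreeKeys_subset_keys _ _
      · refine (ihr h4).imp_of_mem fun {a b} ha hb hab => ?_
        rw [subtreeKeys_node, subtreeKeys_node, if_neg (key a ha).ne', if_neg (key b hb).ne',
          if_neg (key a ha).not_gt, if_neg (key b hb).not_gt]
        exact hab

end BTree

open BTree

/-- `c` and `a` lie strictly on the same side of `s`. -/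
def SameSide (s a c : ℕ) : Prop := (a < s ∧ c < s) ∨ (s < a ∧ s < c)

instance (s a : ℕ) : DecidablePred (SameSide s a) := fun _ =>
  inferInstanceAs (Decidable (_ ∨ _))

theorem subtreeKeys_sameSide {T : BTree} (hT : isBST T) {s a c : ℕ} (hroot : root? T = some s)
    (ha : a ≠ s) (hc : c ∈ subtreeKeys T a) : SameSide s a c := by
  cases T with
  | nil => simp at hc
  | node l x r =>
    obtain rfl : x = s := by simpa [root?] using hroot
    obtain ⟨h1, h2, h3, h4⟩ := hT
    rw [subtreeKeys_node, if_neg ha] at hc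
    unfold SameSide
    split_ifs at hc with h
    · exact .inl ⟨h, h1 _ (subtreeKeys_subset_keys _ _ hc)⟩
    · exact .inr ⟨by omega, h2 _ (subtreeKeys_subset_keys _ _ hc)⟩

theorem subtreeKeys_root {T : BTree} {s : ℕ} (hroot : root? T = some s) :
    subtreeKeys T s = keys T := by
  cases T with
  | nil => simp [root?] at hroot
  | node l x r =>
    obtain rfl : x = s := by simpa [root?] using hroot
    simp [subtreeKeys_node]

theorem afterLeaves_disjoint {T T' : BTree} {s a b : ℕ} (h : IsAccess T s T')
    (ha : a ∈ afterLeaves T s T') (hb : b ∈ afterLeaves T s T') (hab : a ≠ b) :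
    Disjoint (subtreeKeys T' a) (subtreeKeys T' b) := by
  rw [afterLeaves, Finset.mem_filter] at ha hb
  have hk : ∀ {x}, x ∈ pathSet T s → x ∈ keys T' := fun hx =>
    h.hkeys ▸ mem_keys_of_mem_pathSet hx
  rw [Finset.disjoint_left]
  intro c hca hcb
  rcases subtreeKeys_laminar h.hT' (hk ha.1) (hk hb.1) hca hcb with h1 | h1
  · have : a ∈ subtreeKeys T' b ∩ pathSet T s := Finset.mem_inter.2 ⟨h1, ha.1⟩
    rw [hb.2] at this
    exact hab (Finset.mem_singleton.1 this)
  · have : b ∈ subtreeKeys T' a ∩ pathSet T s := Finset.mem_inter.2 ⟨h1, hb.1⟩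
    rw [ha.2] at this
    exact hab (Finset.mem_singleton.1 this).symm

theorem wsum_mono {w : ℕ → ℝ} {X Y K : Finset ℕ} (hw : ∀ i ∈ K, 0 < w i) (hXY : X ⊆ Y)
    (hY : Y ⊆ K) : wsum w X ≤ wsum w Y :=
  Finset.sum_le_sum_of_subset_of_nonneg hXY fun i hi _ => (hw i (hY hi)).le

theorem le_wsum {w : ℕ → ℝ} {Y K : Finset ℕ} (hw : ∀ i ∈ K, 0 < w i) (hY : Y ⊆ K) {a : ℕ}
    (ha : a ∈ Y) : w a ≤ wsum w Y :=
  Finset.single_le_sum (fun i hi => (hw i (hY hi)).le) ha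

/-- Summing over the search path, twice the gains pay for twice the side alternations. -/
theorem two_mul_sideAlt_le (s : ℕ) (h V : ℕ → ℝ) (v : ℝ) (x : ℕ) (l : List ℕ)
    (hh : ∀ a ∈ x :: l, 0 ≤ h a) (hv : ∀ a ∈ x :: l, v ≤ V a)
    (hV : (x :: l).Pairwise fun a b => V b ≤ V a)
    (halt : (x :: l).Pairwise fun a b =>
      (a < s ∧ s < b) ∨ (b < s ∧ s < a) → 2 + V b ≤ h a + h b + V a) :
    2 * (sideAlt s (x :: l) : ℝ) + h x ≤ 2 * ((x :: l).map h).sum + (V x - v) := by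
  induction l generalizing x with
  | nil =>
    have h1 := hh x (by simp)
    have h2 := hv x (by simp)
    simp [sideAlt]
    linarith
  | cons y l ih =>
    have ih := ih y (fun a ha => hh a (by simp_all)) (fun a ha => hv a (by simp_all))
      (List.pairwise_cons.1 hV).2 (List.pairwise_cons.1 halt).2
    have h1 := hh x (by simp)
    have h2 := hh y (by simp)
    have h3 := (List.pairwise_cons.1 hV).1 y (by simp)
    have h4 := (List.pairwise_cons.1 halt).1 y (by simp)
    rw [sideAlt, List.map_cons, List.sum_cons]
    split_ifs with hc
    · have h5 := h4 hc
      push_cast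
      linarith
    · push_cast
      linarith

theorem exists_le_logb_mul (K : ℝ) (hK : 0 ≤ K) : ∃ c : ℝ, 0 ≤ c ∧ ∀ x S : ℝ, 0 < x → 0 < S →
    K ≤ Real.logb 2 S - Real.logb 2 x + c * (Real.logb 2 (S + x) - Real.logb 2 S) := by
  have hp : (0 : ℝ) < 2 ^ (-K) := Real.rpow_pos_of_pos two_pos _
  have hq : 0 < Real.logb 2 (1 + 2 ^ (-K)) := Real.logb_pos one_lt_two (by linarith)
  refine ⟨1 + K / Real.logb 2 (1 + 2 ^ (-K)), by positivity, fun x S hx hS => ?_⟩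
  have h1 : Real.logb 2 x ≤ Real.logb 2 (S + x) :=
    Real.logb_le_logb_of_le one_lt_two hx (by linarith)
  have h2 : Real.logb 2 S ≤ Real.logb 2 (S + x) :=
    Real.logb_le_logb_of_le one_lt_two hS (by linarith)
  have hc : 0 ≤ K / Real.logb 2 (1 + 2 ^ (-K)) := by positivity
  rcases le_total x (S * 2 ^ (-K)) with hxS | hxS
  · have h3 := Real.logb_le_logb_of_le one_lt_two hx hxS
    rw [Real.logb_mul hS.ne' hp.ne', Real.logb_rpow two_pos (by norm_num)] at h3
    nlinarith
  · have h3 : Real.logb 2 (S * (1 + 2 ^ (-K))) ≤ Real.logb 2 (S + x) :=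
      Real.logb_le_logb_of_le one_lt_two (by positivity) (by linarith)
    rw [Real.logb_mul hS.ne' (by positivity)] at h3
    have h4 : K / Real.logb 2 (1 + 2 ^ (-K)) * Real.logb 2 (1 + 2 ^ (-K)) = K :=
      div_mul_cancel₀ K hq.ne'
    nlinarith [mul_le_mul_of_nonneg_left
      (show Real.logb 2 (1 + 2 ^ (-K)) ≤ Real.logb 2 (S + x) - Real.logb 2 S by linarith) hc]

/-- If each `A a` dominates `u` plus the sum of the `x i` over the `i` preceding `a`, then
`∑ log (A a / x a)` is at least `K` per element up to a multiple of the logarithmic growth. -/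
theorem card_mul_le_sum_logb {ι : Type*} [DecidableEq ι] {K c u : ℝ} (hu : 0 < u)
    (hc : ∀ x S : ℝ, 0 < x → 0 < S →
      K ≤ Real.logb 2 S - Real.logb 2 x + c * (Real.logb 2 (S + x) - Real.logb 2 S))
    (f : ι → ℕ) (A x : ι → ℝ) (X : Finset ι) (hx : ∀ a ∈ X, 0 < x a)
    (hA : ∀ a ∈ X, ∀ Y ⊆ X, a ∉ Y → (∀ i ∈ Y, f i ≤ f a) → u + ∑ i ∈ Y, x i ≤ A a) :
    K * X.card ≤ ∑ a ∈ X, (Real.logb 2 (A a) - Real.logb 2 (x a)) +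
      c * (Real.logb 2 (u + ∑ a ∈ X, x a) - Real.logb 2 u) := by
  induction X using Finset.induction_on_max_value f with
  | empty => simp
  | insert a X ha hmax ih =>
    have ih := ih (fun b hb => hx b (Finset.mem_insert_of_mem hb)) fun b hb Y hY =>
      hA b (Finset.mem_insert_of_mem hb) Y (hY.trans (Finset.subset_insert _ _))
    have hS : 0 < u + ∑ i ∈ X, x i :=
      add_pos_of_pos_of_nonneg hu
        (Finset.sum_nonneg fun i hi => (hx i (Finset.mem_insert_of_mem hi)).le)
    have h1 := hc (x a) _ (hx a (Finset.mem_insert_self _ _)) hS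
    have h2 := Real.logb_le_logb_of_le one_lt_two hS
      (hA a (Finset.mem_insert_self _ _) X (Finset.subset_insert _ _) ha hmax)
    rw [Finset.card_insert_of_notMem ha, Finset.sum_insert ha, Finset.sum_insert ha,
      show u + (x a + ∑ i ∈ X, x i) = u + ∑ i ∈ X, x i + x a by ring]
    push_cast
    linarith

/-- If each `x i` is dominated by `G a` for every later `a`, then `∑ log (x a / G a)`
telescopes. -/
theorem sum_logb_le_of_le_later {ι : Type*} [DecidableEq ι] {u : ℝ} (hu : 0 < u)
    (f : ι → ℕ) (G x : ι → ℝ) (X : Finset ι) (M : ℝ) (huM : u ≤ M)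
    (hx : ∀ a ∈ X, 0 < x a) (hxM : ∀ a ∈ X, x a ≤ M) (hG : ∀ a ∈ X, u ≤ G a)
    (hxG : ∀ a ∈ X, ∀ b ∈ X, a ≠ b → f a ≤ f b → x a ≤ G b) :
    ∑ a ∈ X, (Real.logb 2 (x a) - Real.logb 2 (G a)) ≤ Real.logb 2 M - Real.logb 2 u := by
  induction X using Finset.induction_on_max_value f generalizing M with
  | empty =>
    have := Real.logb_le_logb_of_le one_lt_two hu huM
    simpa using this
  | insert a X ha hmax ih =>
    have hmem : ∀ {b}, b ∈ X → b ∈ insert a X := fun hb => Finset.mem_insert_of_mem hb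
    have haX := Finset.mem_insert_self a X
    have ih := ih (G a) (hG a haX) (fun b hb => hx b (hmem hb))
      (fun b hb => hxG b (hmem hb) a haX (fun h => ha (h ▸ hb)) (hmax b hb))
      (fun b hb => hG b (hmem hb)) (fun b hb d hd => hxG b (hmem hb) d (hmem hd))
    have h1 := Real.logb_le_logb_of_le one_lt_two (hx a haX) (hxM a haX)
    rw [Finset.sum_insert ha]
    linarith

section Access

variable {T T' : BTree} {s : ℕ} {w : ℕ → ℝ}

theorem IsAccess.subset_keys (h : IsAccess T s T') (a : ℕ) : subtreeKeys T' a ⊆ keys T :=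
  h.hkeys ▸ subtreeKeys_subset_keys T' a

theorem IsAccess.self_mem (h : IsAccess T s T') {a : ℕ} (ha : a ∈ pathSet T s) :
    a ∈ subtreeKeys T' a :=
  self_mem_subtreeKeys h.hT' (h.hkeys ▸ mem_keys_of_mem_pathSet ha)

theorem IsAccess.s_mem (h : IsAccess T s T') {a : ℕ} (ha : a ∈ pathSet T s) :
    s ∈ subtreeKeys T a :=
  mem_subtreeKeys_of_mem_pathList h.hT h.hs (List.mem_toFinset.1 ha)

theorem IsAccess.mem_of_between (h : IsAccess T s T') {a c : ℕ} (ha : a ∈ pathSet T s)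
    (hc : c ∈ keys T) (hac : (s ≤ c ∧ c ≤ a) ∨ (a ≤ c ∧ c ≤ s)) : c ∈ subtreeKeys T a := by
  have h1 := self_mem_subtreeKeys h.hT (mem_keys_of_mem_pathSet ha)
  rcases hac with hac | hac
  · exact mem_subtreeKeys_of_between h.hT (h.s_mem ha) h1 hc hac.1 hac.2
  · exact mem_subtreeKeys_of_between h.hT h1 (h.s_mem ha) hc hac.1 hac.2

theorem IsAccess.wsum_pos (h : IsAccess T s T') (hw : ∀ i ∈ keys T, 0 < w i) {a : ℕ}
    (ha : a ∈ pathSet T s) : 0 < wsum w (subtreeKeys T' a) :=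
  (hw a (mem_keys_of_mem_pathSet ha)).trans_le (le_wsum hw (h.subset_keys a) (h.self_mem ha))

/-- Weight of the part of `T(a)` on the side of `a`, with `s` shared evenly by the two sides. -/
noncomputable def sideWeight (w : ℕ → ℝ) (T : BTree) (s a : ℕ) : ℝ :=
  wsum w ((subtreeKeys T a).filter (SameSide s a)) + w s / 2

theorem sideWeight_add_le (hw : ∀ i ∈ keys T, 0 < w i) {a b : ℕ} (hs : s ∈ subtreeKeys T a)
    (hab : subtreeKeys T b ⊆ subtreeKeys T a) (hside : (a < s ∧ s < b) ∨ (b < s ∧ s < a)) :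
    sideWeight w T s a + sideWeight w T s b ≤ wsum w (subtreeKeys T a) := by
  have hd : Disjoint ((subtreeKeys T a).filter (SameSide s a))
      ((subtreeKeys T b).filter (SameSide s b)) := by
    rw [Finset.disjoint_left]
    intro c h1 h2
    simp only [Finset.mem_filter, SameSide] at h1 h2
    omega
  have hsn : s ∉ (subtreeKeys T a).filter (SameSide s a) ∪
      (subtreeKeys T b).filter (SameSide s b) := by
    simp [SameSide]
  have hsub : insert s ((subtreeKeys T a).filter (SameSide s a) ∪
      (subtreeKeys T b).filter (SameSide s b)) ⊆ subtreeKeys T a :=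
    Finset.insert_subset hs (Finset.union_subset (Finset.filter_subset _ _)
      ((Finset.filter_subset _ _).trans hab))
  have := wsum_mono hw hsub (subtreeKeys_subset_keys T a)
  simp only [sideWeight, wsum] at this ⊢
  rw [Finset.sum_insert hsn, Finset.sum_union hd] at this
  linarith

theorem half_le_sideWeight (hw : ∀ i ∈ keys T, 0 < w i) (a : ℕ) :
    w s / 2 ≤ sideWeight w T s a :=
  le_add_of_nonneg_left (Finset.sum_nonneg fun i hi =>
    (hw i (subtreeKeys_subset_keys T a (Finset.mem_of_mem_filter i hi))).le)

theorem sideWeight_le (hw : ∀ i ∈ keys T, 0 < w i) {a : ℕ} (hs : s ∈ subtreeKeys T a) :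
    sideWeight w T s a ≤ wsum w (subtreeKeys T a) := by
  have hsn : s ∉ (subtreeKeys T a).filter (SameSide s a) := by simp [SameSide]
  have := wsum_mono hw (Finset.insert_subset hs (Finset.filter_subset (SameSide s a) _))
    (subtreeKeys_subset_keys T a)
  have h0 := hw s (subtreeKeys_subset_keys T a hs)
  simp only [sideWeight, wsum] at this ⊢
  rw [Finset.sum_insert hsn] at this
  linarith

/-- The side alternations are paid for by the gains `log (w(T(a)) / sideWeight a)` of the path
nodes outside any set `B`, up to two units per element of `B`. -/
theorem IsAccess.sideAlt_le (h : IsAccess T s T') (hw : ∀ i ∈ keys T, 0 < w i) {B : Finset ℕ}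
    (hB : B ⊆ (pathSet T s).erase s) :
    (sideAlt s (pathList s T) : ℝ) ≤
      ∑ a ∈ (pathSet T s).erase s \ B,
        (Real.logb 2 (wsum w (subtreeKeys T a)) - Real.logb 2 (sideWeight w T s a)) +
      2 * B.card + (Real.logb 2 (wsum w (keys T)) - Real.logb 2 (w s)) := by
  set gain : ℕ → ℝ := fun a =>
    Real.logb 2 (wsum w (subtreeKeys T a)) - Real.logb 2 (sideWeight w T s a)
  set V : ℕ → ℝ := fun a => Real.logb 2 (wsum w (subtreeKeys T a))
  set g : ℕ → ℝ := fun a => if a ∈ B then 2 else if a = s then 0 else gain a with hg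
  have hws := hw s h.hs
  have hside : ∀ a, 0 < sideWeight w T s a := fun a =>
    (half_pos hws).trans_le (half_le_sideWeight hw a)
  have hgain : ∀ a ∈ pathSet T s, 0 ≤ gain a := fun a ha =>
    sub_nonneg.2 (Real.logb_le_logb_of_le one_lt_two (hside a) (sideWeight_le hw (h.s_mem ha)))
  have hg0 : ∀ a ∈ pathSet T s, 0 ≤ g a := by
    intro a ha
    simp only [hg]
    split_ifs
    · norm_num
    · exact le_rfl
    · exact hgain a ha
  have hsV : ∀ a ∈ pathSet T s, w s ≤ wsum w (subtreeKeys T a) := fun a ha =>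
    le_wsum hw (subtreeKeys_subset_keys T a) (h.s_mem ha)
  have hmono : ∀ a b, b ∈ pathSet T s → subtreeKeys T b ⊆ subtreeKeys T a → V b ≤ V a :=
    fun a b hb hab => Real.logb_le_logb_of_le one_lt_two (hws.trans_le (hsV b hb))
      (wsum_mono hw hab (subtreeKeys_subset_keys T a))
  have hmem : ∀ {a}, a ∈ pathList s T → a ∈ pathSet T s := fun ha => List.mem_toFinset.2 ha
  have hpw := pathList_pairwise h.hT s
  have hsum : ((pathList s T).map g).sum =
      ∑ a ∈ (pathSet T s).erase s \ B, gain a + 2 * B.card := by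
    have hnd : (pathList s T).Nodup := hpw.imp fun hab => hab.1
    have hsB : s ∉ B := fun hs => (Finset.mem_erase.1 (hB hs)).1 rfl
    have hs : s ∈ pathSet T s := hmem (self_mem_pathList h.hT h.hs)
    rw [← List.sum_toFinset g hnd]
    change ∑ a ∈ pathSet T s, g a = _
    rw [← Finset.add_sum_erase _ _ hs, ← Finset.sum_sdiff hB]
    have h1 : g s = 0 := by simp [hg, hsB]
    have h2 : ∑ a ∈ B, g a = 2 * B.card := by
      rw [Finset.sum_congr rfl (g := fun _ => (2 : ℝ)) fun a ha => if_pos ha]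
      simp [mul_comm]
    have h3 : ∑ a ∈ (pathSet T s).erase s \ B, g a = ∑ a ∈ (pathSet T s).erase s \ B, gain a := by
      refine Finset.sum_congr rfl fun a ha => ?_
      simp only [Finset.mem_sdiff, Finset.mem_erase] at ha
      simp [hg, ha.1.1, ha.2]
    rw [h1, h2, h3, zero_add]
  have halt : (pathList s T).Pairwise fun a b =>
      (a < s ∧ s < b) ∨ (b < s ∧ s < a) → 2 + V b ≤ g a + g b + V a := by
    refine hpw.imp_of_mem fun {a b} ha hb hab hside' => ?_
    have h1 := hg0 a (hmem ha)
    have h2 := hg0 b (hmem hb)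
    have h3 := hmono a b (hmem hb) hab.2
    by_cases haB : a ∈ B
    · have : g a = 2 := if_pos haB
      linarith
    by_cases hbB : b ∈ B
    · have : g b = 2 := if_pos hbB
      linarith
    have hga : g a = gain a := by
      simp only [hg, if_neg haB]
      exact if_neg (by omega)
    have hgb : g b = gain b := by
      simp only [hg, if_neg hbB]
      exact if_neg (by omega)
    have h4 := sideWeight_add_le hw (h.s_mem (hmem ha)) hab.2 hside'
    have pa := hside a
    have pb := hside b
    have h5 : Real.logb 2 (4 * (sideWeight w T s a * sideWeight w T s b)) ≤
        Real.logb 2 (wsum w (subtreeKeys T a) ^ 2) :=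
      Real.logb_le_logb_of_le one_lt_two (by positivity)
        (by nlinarith [sq_nonneg (sideWeight w T s a - sideWeight w T s b)])
    rw [Real.logb_mul (by norm_num) (by positivity), Real.logb_mul pa.ne' pb.ne',
      Real.logb_pow, show (4 : ℝ) = 2 ^ 2 by norm_num, Real.logb_pow,
      Real.logb_self_eq_one one_lt_two] at h5
    push_cast at h5
    rw [hga, hgb]
    simp only [gain, V]
    linarith
  obtain ⟨x, l, hl⟩ := List.exists_cons_of_ne_nil
    (List.ne_nil_of_mem (self_mem_pathList h.hT h.hs))
  have hx : x ∈ pathSet T s := hmem (by rw [hl]; exact List.mem_cons_self)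
  have key := two_mul_sideAlt_le s g V (Real.logb 2 (w s)) x l
    (hl ▸ fun a ha => hg0 a (hmem ha))
    (hl ▸ fun a ha => Real.logb_le_logb_of_le one_lt_two hws (hsV a (hmem ha)))
    (hl ▸ hpw.imp_of_mem fun {a b} _ hb hab => hmono a b (hmem hb) hab.2) (hl ▸ halt)
  rw [← hl, hsum] at key
  have h1 := hg0 x hx
  have h2 : V x ≤ Real.logb 2 (wsum w (keys T)) :=
    Real.logb_le_logb_of_le one_lt_two (hws.trans_le (hsV x hx))
      (wsum_mono hw (subtreeKeys_subset_keys T x) subset_rfl)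
  have h3 : Real.logb 2 (w s) ≤ Real.logb 2 (wsum w (keys T)) :=
    Real.logb_le_logb_of_le one_lt_two hws (le_wsum hw subset_rfl h.hs)
  linarith

theorem IsAccess.card_leaves_le (h : IsAccess T s T') (hw : ∀ i ∈ keys T, 0 < w i) {K c : ℝ}
    (hc0 : 0 ≤ c)
    (hc : ∀ x S : ℝ, 0 < x → 0 < S →
      K ≤ Real.logb 2 S - Real.logb 2 x + c * (Real.logb 2 (S + x) - Real.logb 2 S))
    {B : Finset ℕ} (hB : B ⊆ (afterLeaves T s T').erase s)
    (hside : ∀ a ∈ B, ∀ b ∈ B, SameSide s a b) :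
    K * B.card ≤ ∑ a ∈ B, (Real.logb 2 (wsum w (subtreeKeys T a)) -
        Real.logb 2 (wsum w (subtreeKeys T' a))) +
      c * (Real.logb 2 (wsum w (keys T)) - Real.logb 2 (w s)) := by
  have hws := hw s h.hs
  have hleaf : ∀ a ∈ B, a ∈ afterLeaves T s T' := fun a ha => (Finset.mem_erase.1 (hB ha)).2
  have hne : ∀ a ∈ B, a ≠ s := fun a ha => (Finset.mem_erase.1 (hB ha)).1
  have hpath : ∀ a ∈ B, a ∈ pathSet T s := fun a ha => Finset.mem_of_mem_filter a (hleaf a ha)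
  have hpos : ∀ a ∈ B, 0 < wsum w (subtreeKeys T' a) := fun a ha => h.wsum_pos hw (hpath a ha)
  have hsum : ∀ Y ⊆ B, ∀ Z ⊆ keys T, s ∈ Z → (∀ i ∈ Y, subtreeKeys T' i ⊆ Z) →
      w s + ∑ i ∈ Y, wsum w (subtreeKeys T' i) ≤ wsum w Z := by
    intro Y hY Z hZ hsZ hsub
    have hsn : s ∉ Y.biUnion (subtreeKeys T') := by
      simp only [Finset.mem_biUnion, not_exists, not_and]
      intro i hi hsi
      have := subtreeKeys_sameSide h.hT' h.hroot (hne i (hY hi)) hsi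
      simp [SameSide] at this
    have := wsum_mono hw (Finset.insert_subset hsZ (Finset.biUnion_subset.2 hsub)) hZ
    rw [wsum, Finset.sum_insert hsn, Finset.sum_biUnion] at this
    · exact this
    · exact fun a ha b hb hab => afterLeaves_disjoint h (hleaf a (hY ha)) (hleaf b (hY hb)) hab
  have key := card_mul_le_sum_logb hws hc (Nat.dist s) (fun a => wsum w (subtreeKeys T a))
    (fun a => wsum w (subtreeKeys T' a)) B hpos ?_
  · have h1 := Real.logb_le_logb_of_le one_lt_two
      (add_pos_of_pos_of_nonneg hws (Finset.sum_nonneg fun i hi => (hpos i hi).le))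
      (hsum B subset_rfl (keys T) subset_rfl h.hs fun i _ => h.subset_keys i)
    have h2 := mul_le_mul_of_nonneg_left
      (sub_le_sub_right h1 (Real.logb 2 (w s))) hc0
    linarith
  · intro a ha Y hY haY hdist
    refine hsum Y hY _ (subtreeKeys_subset_keys T a) (h.s_mem (hpath a ha)) fun i hi e he => ?_
    have hia : i ≠ a := fun hia => haY (hia ▸ hi)
    have h1 := subtreeKeys_sameSide h.hT' h.hroot (hne i (hY hi)) he
    have h2 := hside i (hY hi) a ha
    have h3 := hdist i hi
    have h4 : a ∉ subtreeKeys T' i := fun h4 =>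
      Finset.disjoint_left.1 (afterLeaves_disjoint h (hleaf i (hY hi)) (hleaf a ha) hia) h4
        (h.self_mem (hpath a ha))
    have hak : a ∈ keys T' := h.hkeys ▸ mem_keys_of_mem_pathSet (hpath a ha)
    have hii := h.self_mem (hpath i (hY hi))
    refine h.mem_of_between (hpath a ha) (h.subset_keys i he) ?_
    simp only [SameSide, Nat.dist] at h1 h2 h3
    by_contra hcon
    rcases h2 with h2 | h2
    · exact h4 (mem_subtreeKeys_of_between h.hT' he hii hak (by omega) (by omega))
    · exact h4 (mem_subtreeKeys_of_between h.hT' hii he hak (by omega) (by omega))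

theorem IsAccess.monotone_sum_le (h : IsAccess T s T') (hw : ∀ i ∈ keys T, 0 < w i)
    {X : Finset ℕ} (hX : X ⊆ pathSet T s) (hmono : IsMonotone s T' X) :
    ∑ a ∈ X, (Real.logb 2 (wsum w (subtreeKeys T' a)) - Real.logb 2 (sideWeight w T s a)) ≤
      1 + (Real.logb 2 (wsum w (keys T)) - Real.logb 2 (w s)) := by
  have hws := hw s h.hs
  have hsW : w s ≤ wsum w (keys T) := le_wsum hw subset_rfl h.hs
  have key := sum_logb_le_of_le_later (half_pos hws) (Nat.dist s) (sideWeight w T s)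
    (fun a => wsum w (subtreeKeys T' a)) X (wsum w (keys T)) (by linarith)
    (fun a ha => h.wsum_pos hw (hX ha))
    (fun a _ => wsum_mono hw (h.subset_keys a) subset_rfl)
    (fun a _ => half_le_sideWeight hw a) ?_
  · rw [Real.logb_div hws.ne' two_ne_zero, Real.logb_self_eq_one one_lt_two] at key
    linarith
  · intro a ha b hb hab hdist
    have hak : a ∈ keys T' := h.hkeys ▸ mem_keys_of_mem_pathSet (hX ha)
    have hbk : b ∈ keys T' := h.hkeys ▸ mem_keys_of_mem_pathSet (hX hb)
    have hsub : subtreeKeys T' a ⊆ (subtreeKeys T b).filter (SameSide s b) := by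
      intro e he
      have hek := h.subset_keys a he
      simp only [Nat.dist] at hdist
      rw [Finset.mem_filter]
      rcases hmono with ⟨hgt, d, hd⟩ | ⟨hlt, d, hd⟩
      · have h1 := hgt a ha
        have h2 := hgt b hb
        have h3 := lt_of_rightDepth_eq h.hT' hak hbk (by omega) ((hd a ha).trans (hd b hb).symm) he
        have h4 := subtreeKeys_sameSide h.hT' h.hroot (by omega) he
        simp only [SameSide] at h4 ⊢
        exact ⟨h.mem_of_between (hX hb) hek (by omega), by omega⟩
      · have h1 := hlt a ha
        have h2 := hlt b hb
        have h3 := lt_of_leftDepth_eq h.hT' hak hbk (by omega) ((hd a ha).trans (hd b hb).symm) he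
        have h4 := subtreeKeys_sameSide h.hT' h.hroot (by omega) he
        simp only [SameSide] at h4 ⊢
        exact ⟨h.mem_of_between (hX hb) hek (by omega), by omega⟩
    have h1 := wsum_mono hw hsub
      ((Finset.filter_subset _ _).trans (subtreeKeys_subset_keys T b))
    simp only [sideWeight]
    linarith

theorem IsAccess.sum_le_of_depth_le (h : IsAccess T s T') (hw : ∀ i ∈ keys T, 0 < w i)
    {X : Finset ℕ} (hX : X ⊆ pathSet T s) {D : ℕ} (depth : ℕ → ℕ) (hD : ∀ a ∈ X, depth a ≤ D)
    (hmono : ∀ d, IsMonotone s T' (X.filter fun a => depth a = d)) :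
    ∑ a ∈ X, (Real.logb 2 (wsum w (subtreeKeys T' a)) - Real.logb 2 (sideWeight w T s a)) ≤
      (D + 1) * (1 + (Real.logb 2 (wsum w (keys T)) - Real.logb 2 (w s))) := by
  rw [← Finset.sum_fiberwise_of_maps_to (t := Finset.range (D + 1)) (g := depth)
    fun a ha => Finset.mem_range.2 (Nat.lt_succ_of_le (hD a ha))]
  refine (Finset.sum_le_sum fun d _ =>
    h.monotone_sum_le hw ((Finset.filter_subset _ _).trans hX) (hmono d)).trans_eq ?_
  rw [Finset.sum_const, Finset.card_range, nsmul_eq_mul, Nat.cast_add_one]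

theorem IsAccess.phiAll_sub (h : IsAccess T s T') :
    phiAll w T - phiAll w T' = ∑ a ∈ pathSet T s, (Real.logb 2 (wsum w (subtreeKeys T a)) -
      Real.logb 2 (wsum w (subtreeKeys T' a))) := by
  rw [phiAll, phiAll, phiOn, phiOn, h.hkeys, ← Finset.sum_sub_distrib]
  refine (Finset.sum_subset (fun a ha => mem_keys_of_mem_pathSet ha) fun a ha hap => ?_).symm
  rw [subtreeKeys, subtreeKeys, h.hpendent a ha hap, sub_self]

end Access

end Paper

open Paper Paper.BTree
/-- **Theorem 1 (main theorem).** If every access of the minimally self-adjusting BST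
algorithm `Alg` produces an after-tree rooted at the accessed element `s` whose number of
leaves is at least `α·(|P| − z)` (with `z` the number of side alternations of the search
path `P`), and in which every path element larger (smaller) than `s` has right-depth
(left-depth) at most `D`, then `Alg` satisfies the access lemma via the SOL potential. -/
theorem main_theorem (Alg : BTree → ℕ → BTree → Prop)
    (hvalid : ∀ T s T', Alg T s T' → IsAccess T s T')
    (α : ℝ) (hα : 0 < α) (D : ℕ)
    (hleaves : ∀ T s T', Alg T s T' →
      α * (((pathSet T s).card : ℝ) - (sideAlt s (pathList s T) : ℝ)) ≤
        ((afterLeaves T s T').card : ℝ))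
    (hrdepth : ∀ T s T', Alg T s T' →
      ∀ x ∈ pathSet T s, s < x → rightDepth x T' ≤ D)
    (hldepth : ∀ T s T', Alg T s T' →
      ∀ x ∈ pathSet T s, x < s → leftDepth x T' ≤ D) :
    SatisfiesAL Alg := by
  have hK : 0 ≤ 2 + 1 / α := by positivity
  obtain ⟨c, hc0, hc⟩ := exists_le_logb_mul (2 + 1 / α) hK
  refine ⟨1 / α + 2 * c + 2 * (D + 1) + 2, by positivity, fun T s T' hA w hw => ?_⟩
  have h := hvalid T s T' hA
  have hws := hw s h.hs
  have hsW : w s ≤ wsum w (keys T) := le_wsum hw subset_rfl h.hs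
  have hsP : s ∈ pathSet T s := List.mem_toFinset.2 (self_mem_pathList h.hT h.hs)
  rw [Real.logb_div (hws.trans_le hsW).ne' hws.ne', h.phiAll_sub]
  set L := Real.logb 2 (wsum w (keys T)) - Real.logb 2 (w s) with hL
  have hL0 : 0 ≤ L := sub_nonneg.2 (Real.logb_le_logb_of_le one_lt_two hws hsW)
  set B := (afterLeaves T s T').erase s with hBdef
  have hBP : B ⊆ (pathSet T s).erase s := Finset.erase_subset_erase _ (Finset.filter_subset _ _)
  have hne : ∀ a ∈ (pathSet T s).erase s, a ≠ s := fun a ha => (Finset.mem_erase.1 ha).1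
  have hsplit := Finset.add_sum_erase (pathSet T s) (fun a =>
    Real.logb 2 (wsum w (subtreeKeys T a)) - Real.logb 2 (wsum w (subtreeKeys T' a))) hsP
  rw [← Finset.sum_sdiff hBP] at hsplit
  -- the accessed element
  have hs : -L ≤ Real.logb 2 (wsum w (subtreeKeys T s)) -
      Real.logb 2 (wsum w (subtreeKeys T' s)) := by
    have := Real.logb_le_logb_of_le one_lt_two hws
      (le_wsum hw (subtreeKeys_subset_keys T s) (h.s_mem hsP))
    rw [subtreeKeys_root h.hroot, h.hkeys]
    linarith
  -- the leaves
  have hleafSum : (2 + 1 / α) * B.card ≤ ∑ a ∈ B, (Real.logb 2 (wsum w (subtreeKeys T a)) -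
      Real.logb 2 (wsum w (subtreeKeys T' a))) + 2 * c * L := by
    have h1 := h.card_leaves_le hw hc0 hc (B := B.filter fun a => a < s)
      (Finset.filter_subset _ _) (by
        intro a ha b hb
        exact .inl ⟨(Finset.mem_filter.1 ha).2, (Finset.mem_filter.1 hb).2⟩)
    have h2 := h.card_leaves_le hw hc0 hc (B := B.filter fun a => ¬ a < s)
      (Finset.filter_subset _ _) (by
        intro a ha b hb
        rw [Finset.mem_filter] at ha hb
        have := hne a (hBP ha.1)
        have := hne b (hBP hb.1)
        exact .inr ⟨by omega, by omega⟩)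
    rw [← Finset.sum_filter_add_sum_filter_not B (fun a => a < s),
      ← Finset.card_filter_add_card_filter_not (s := B) (fun a => a < s)]
    push_cast
    linarith
  -- the remaining path elements
  have hrest : ∑ a ∈ (pathSet T s).erase s \ B, (Real.logb 2 (wsum w (subtreeKeys T' a)) -
      Real.logb 2 (sideWeight w T s a)) ≤ 2 * ((D + 1) * (1 + L)) := by
    have hXP : (pathSet T s).erase s \ B ⊆ pathSet T s :=
      Finset.sdiff_subset.trans (Finset.erase_subset _ _)
    have hgt : ∀ a ∈ ((pathSet T s).erase s \ B).filter (fun a => ¬ a < s), s < a := by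
      intro a ha
      rw [Finset.mem_filter] at ha
      have := hne a (Finset.sdiff_subset ha.1)
      omega
    have hlt : ∀ a ∈ ((pathSet T s).erase s \ B).filter (fun a => a < s), a < s :=
      fun a ha => (Finset.mem_filter.1 ha).2
    have h1 := h.sum_le_of_depth_le hw (D := D) ((Finset.filter_subset (fun a => a < s) _).trans hXP)
      (fun a => leftDepth a T')
      (fun a ha => hldepth T s T' hA a (hXP (Finset.mem_of_mem_filter a ha)) (hlt a ha))
      fun d => .inr ⟨fun a ha => hlt a (Finset.mem_of_mem_filter a ha), d,
        fun a ha => (Finset.mem_filter.1 ha).2⟩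
    have h2 := h.sum_le_of_depth_le hw (D := D) ((Finset.filter_subset (fun a => ¬ a < s) _).trans hXP)
      (fun a => rightDepth a T')
      (fun a ha => hrdepth T s T' hA a (hXP (Finset.mem_of_mem_filter a ha)) (hgt a ha))
      fun d => .inl ⟨fun a ha => hgt a (Finset.mem_of_mem_filter a ha), d,
        fun a ha => (Finset.mem_filter.1 ha).2⟩
    rw [← Finset.sum_filter_add_sum_filter_not _ (fun a => a < s)]
    linarith
  have hz := h.sideAlt_le hw hBP
  rw [← hL] at hz
  have hcard : (pathSet T s).card - (sideAlt s (pathList s T) : ℝ) ≤ 1 / α * B.card + 1 / α := by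
    have h1 := hleaves T s T' hA
    have h2 : ((afterLeaves T s T').card : ℝ) ≤ B.card + 1 := by
      have := Finset.pred_card_le_card_erase (s := afterLeaves T s T') (a := s)
      rw [← hBdef] at this
      exact_mod_cast (by omega : (afterLeaves T s T').card ≤ B.card + 1)
    rw [← mul_add_one, one_div, ← div_eq_inv_mul, le_div_iff₀' hα]
    linarith
  have hsums : ∑ a ∈ (pathSet T s).erase s \ B, (Real.logb 2 (wsum w (subtreeKeys T a)) -
        Real.logb 2 (wsum w (subtreeKeys T' a))) =
      ∑ a ∈ (pathSet T s).erase s \ B, (Real.logb 2 (wsum w (subtreeKeys T a)) -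
        Real.logb 2 (sideWeight w T s a)) -
      ∑ a ∈ (pathSet T s).erase s \ B, (Real.logb 2 (wsum w (subtreeKeys T' a)) -
        Real.logb 2 (sideWeight w T s a)) := by
    rw [← Finset.sum_sub_distrib]
    exact Finset.sum_congr rfl fun a _ => by ring
  have hαL : 0 ≤ 1 / α * L := by positivity
  nlinarith
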